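/- arXiv:1903.03694 — 2 statements merged into one kernel-verified Lean document; each statement's English description precedes it below -/
import Mathlib

section
/- Let (Ξ, μ) be a probability space, Ω ⊆ ℝ^d a convex set, and f : ℝ^d × Ξ → ℝ a measurable function such that for every ξ ∈ Ξ the map w ↦ f(w;ξ) is nonnegative, convex, differentiable, β-smooth and λ-strongly convex (λ ≥ 0), and let r : ℝ^d → ℝ be γ-strongly convex. Define G(w) = E_{ξ∼μ}[f(w;ξ)] and, for Z = (ξ₁,…,ξ_n) ∈ Ξⁿ, Ĝ_Z(w) = (1/n)∑_{i=1}^n f(w;ξ_i) and F̂_Z(w) = Ĝ_Z(w) + r(w). Let ŵ : Ξⁿ → Ω be a measurable map with ŵ(Z) ∈ argmin_{w∈Ω} F̂_Z(w) for every Z. If (λ+γ)n ≥ 8β, then (1 − 8β/((λ+γ)n))·E_{Z∼μⁿ}[G(ŵ(Z))] ≤ E_{Z∼μⁿ}[Ĝ_Z(ŵ(Z))], where Z consists of n i.i.d. draws from μ. -/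
open MeasureTheory
open scoped RealInnerProductSpace

lemma aux_swap {n : ℕ} {Ξ : Type*} [MeasurableSpace Ξ] (μ : Measure Ξ) [IsProbabilityMeasure μ]
    (i : Fin n) :
    MeasurePreserving (fun p : (Fin n → Ξ) × Ξ => (Function.update p.1 i p.2, p.1 i))
      ((Measure.pi fun _ : Fin n => μ).prod μ) ((Measure.pi fun _ : Fin n => μ).prod μ) := by
  have hT : Measurable (fun p : (Fin n → Ξ) × Ξ => (Function.update p.1 i p.2, p.1 i)) := by
    refine Measurable.prodMk ?_ ((measurable_pi_apply i).comp measurable_fst)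
    refine measurable_pi_lambda _ fun j => ?_
    by_cases h : j = i
    · subst h
      simpa using measurable_snd
    · simpa [Function.update_of_ne h, Function.comp_def] using
        (measurable_pi_apply (X := fun _ : Fin n => Ξ) j).comp (measurable_fst (β := Ξ))
  refine ⟨hT, ?_⟩
  symm
  refine Measure.prod_eq_generateFrom (generateFrom_pi (α := fun _ : Fin n => Ξ))
    (MeasurableSpace.generateFrom_measurableSet (α := Ξ)) isPiSystem_pi
    MeasurableSpace.isPiSystem_measurableSet
    ⟨fun _ => Set.univ, fun _ => ⟨fun _ => Set.univ, by simp, by simp⟩, by simp,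
      by simp [Set.iUnion_const]⟩
    ⟨fun _ => Set.univ, fun _ => MeasurableSet.univ, by simp, by simp [Set.iUnion_const]⟩ ?_
  rintro _ ⟨s, hs, rfl⟩ t ht
  have hs' : ∀ j, MeasurableSet (s j) := fun j => hs j (Set.mem_univ j)
  rw [Measure.map_apply hT ((MeasurableSet.univ_pi hs').prod ht)]
  have : (fun p : (Fin n → Ξ) × Ξ => (Function.update p.1 i p.2, p.1 i)) ⁻¹'
      ((Set.univ.pi s) ×ˢ t) = (Set.univ.pi (Function.update s i t)) ×ˢ (s i) := by
    ext ⟨Z, x⟩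
    simp only [Set.mem_preimage, Set.mem_prod, Set.mem_univ_pi]
    constructor
    · rintro ⟨h1, h2⟩
      refine ⟨fun j => ?_, by simpa using h1 i⟩
      by_cases h : j = i
      · subst h; simpa using h2
      · simpa [Function.update_of_ne h] using h1 j
    · rintro ⟨h1, h2⟩
      refine ⟨fun j => ?_, by simpa using h1 i⟩
      by_cases h : j = i
      · subst h; simpa using h2
      · simpa [Function.update_of_ne h] using h1 j
  rw [this, Measure.prod_prod, Measure.pi_pi, Measure.pi_pi,
    ← Finset.mul_prod_erase Finset.univ _ (Finset.mem_univ i),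
    ← Finset.mul_prod_erase Finset.univ (fun j => μ (s j)) (Finset.mem_univ i)]
  have : ∏ j ∈ Finset.univ.erase i, μ (Function.update s i t j)
      = ∏ j ∈ Finset.univ.erase i, μ (s j) := by
    refine Finset.prod_congr rfl fun j hj => ?_
    rw [Function.update_of_ne (Finset.ne_of_mem_erase hj)]
  rw [this]
  simp only [Function.update_self]
  ring

lemma aux_mid {E : Type*} [NormedAddCommGroup E] [InnerProductSpace ℝ E] (h : E → ℝ) (g : E → E)
    (m : ℝ) (H : ∀ w₁ w₂, h w₂ + ⟪g w₂, w₁ - w₂⟫ + m / 2 * ‖w₁ - w₂‖ ^ 2 ≤ h w₁) (u v : E) :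
    h ((1/2:ℝ) • u + (1/2:ℝ) • v) + m / 8 * ‖u - v‖ ^ 2 ≤ (h u + h v) / 2 := by
  have h1 := H u ((1/2:ℝ) • u + (1/2:ℝ) • v)
  have h2 := H v ((1/2:ℝ) • u + (1/2:ℝ) • v)
  have e1 : u - ((1/2:ℝ) • u + (1/2:ℝ) • v) = (1/2:ℝ) • (u - v) := by module
  have e2 : v - ((1/2:ℝ) • u + (1/2:ℝ) • v) = -((1/2:ℝ) • (u - v)) := by module
  rw [e1] at h1
  rw [e2, inner_neg_right, norm_neg] at h2
  have e3 : ‖(1/2:ℝ) • (u - v)‖ ^ 2 = 1/4 * ‖u - v‖ ^ 2 := by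
    rw [norm_smul, mul_pow]; norm_num
  rw [e3] at h1 h2
  linarith

lemma aux_self {E : Type*} [NormedAddCommGroup E] [InnerProductSpace ℝ E] (h : E → ℝ) (g : E → E)
    (β : ℝ) (hβ : 0 < β) (h0 : ∀ w, 0 ≤ h w)
    (H : ∀ w₁ w₂, h w₁ ≤ h w₂ + ⟪g w₂, w₁ - w₂⟫ + β / 2 * ‖w₁ - w₂‖ ^ 2) (w : E) :
    ‖g w‖ ^ 2 ≤ 2 * β * h w := by
  have h1 := H (w - (1/β) • g w) w
  have h2 := h0 (w - (1/β) • g w)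
  have e1 : w - (1/β) • g w - w = -((1/β) • g w) := by abel
  rw [e1, inner_neg_right, norm_neg, inner_smul_right, real_inner_self_eq_norm_sq, norm_smul,
    mul_pow, Real.norm_eq_abs, sq_abs] at h1
  have h3 : 0 ≤ h w - 1 / (2 * β) * ‖g w‖ ^ 2 := by
    have : -(1 / β * ‖g w‖ ^ 2) + β / 2 * ((1/β) ^ 2 * ‖g w‖ ^ 2)
      = - (1 / (2 * β) * ‖g w‖ ^ 2) := by field_simp; ring
    linarith
  have h4 := mul_nonneg (by positivity : 0 ≤ 2 * β) h3
  have h5 : 2 * β * (h w - 1 / (2 * β) * ‖g w‖ ^ 2) = 2 * β * h w - ‖g w‖ ^ 2 := by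
    field_simp
  linarith

lemma aux_alg {E : Type*} [NormedAddCommGroup E] [InnerProductSpace ℝ E] (g1 g2 δ : E)
    (A D K : ℝ) (hA : 0 < A) (h1 : A * ‖δ‖ ^ 2 ≤ D) (h2 : D ≤ ⟪g1, δ⟫ - ⟪g2, δ⟫)
    (h3 : 2 * (‖g1‖ ^ 2 + ‖g2‖ ^ 2) ≤ K) : A * D ≤ K := by
  have h4 : ‖(g1 - g2) - A • δ‖ ^ 2 = ‖g1 - g2‖ ^ 2 - 2 * (A * ⟪g1 - g2, δ⟫)
      + A ^ 2 * ‖δ‖ ^ 2 := by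
    rw [norm_sub_sq_real, inner_smul_right, norm_smul, mul_pow, Real.norm_eq_abs, sq_abs]
  have h5 : ‖g1 - g2‖ ^ 2 ≤ 2 * (‖g1‖ ^ 2 + ‖g2‖ ^ 2) := by
    have := parallelogram_law_with_norm ℝ g1 g2
    nlinarith [sq_nonneg ‖g1 + g2‖]
  have h6 := sq_nonneg ‖(g1 - g2) - A • δ‖
  rw [h4, inner_sub_left] at h6
  have h7 := mul_le_mul_of_nonneg_left h1 hA.le
  have h8 := mul_le_mul_of_nonneg_left h2 hA.le
  nlinarith

theorem stmt17
    {d n : ℕ} (hn : 0 < n)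
    {Ξ : Type*} [MeasurableSpace Ξ] (μ : Measure Ξ) [IsProbabilityMeasure μ]
    (Ωs : Set (EuclideanSpace ℝ (Fin d))) (hΩs : Convex ℝ Ωs)
    (f : EuclideanSpace ℝ (Fin d) → Ξ → ℝ) (r : EuclideanSpace ℝ (Fin d) → ℝ)
    (β lam γ : ℝ) (hβ : 0 < β) (hlam : 0 ≤ lam)
    (hf_meas : ∀ w, Measurable (f w))
    (hf_nonneg : ∀ ξ w, 0 ≤ f w ξ)
    (hf_convex : ∀ ξ, ConvexOn ℝ Set.univ fun w => f w ξ)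
    (hf_diff : ∀ ξ, Differentiable ℝ fun w => f w ξ)
    (hf_smooth : ∀ ξ w₁ w₂,
      f w₁ ξ ≤ f w₂ ξ + ⟪gradient (fun w => f w ξ) w₂, w₁ - w₂⟫ +
        β / 2 * ‖w₁ - w₂‖ ^ 2)
    (hf_strconv : ∀ ξ w₁ w₂,
      f w₂ ξ + ⟪gradient (fun w => f w ξ) w₂, w₁ - w₂⟫ +
        lam / 2 * ‖w₁ - w₂‖ ^ 2 ≤ f w₁ ξ)
    (hr_diff : Differentiable ℝ r)
    (hr_strconv : ∀ w₁ w₂,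
      r w₂ + ⟪gradient r w₂, w₁ - w₂⟫ + γ / 2 * ‖w₁ - w₂‖ ^ 2 ≤ r w₁)
    (G : EuclideanSpace ℝ (Fin d) → ℝ) (hG : ∀ w, G w = ∫ ξ, f w ξ ∂μ)
    (hG_int : ∀ w, Integrable (f w) μ)
    (Ghat : (Fin n → Ξ) → EuclideanSpace ℝ (Fin d) → ℝ)
    (hGhat : ∀ Z w, Ghat Z w = (1 / n : ℝ) * ∑ i, f w (Z i))
    (what : (Fin n → Ξ) → EuclideanSpace ℝ (Fin d))
    (hwhat_meas : Measurable what)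
    (hwhat_mem : ∀ Z, what Z ∈ Ωs)
    (hwhat_min : ∀ Z, ∀ w ∈ Ωs, Ghat Z (what Z) + r (what Z) ≤ Ghat Z w + r w)
    (hInt1 : Integrable (fun Z => G (what Z)) (Measure.pi fun _ : Fin n => μ))
    (hInt2 : Integrable (fun Z => Ghat Z (what Z)) (Measure.pi fun _ : Fin n => μ))
    (hcond : 8 * β ≤ (lam + γ) * n) :
    (1 - 8 * β / ((lam + γ) * n)) *
        ∫ Z, G (what Z) ∂(Measure.pi fun _ : Fin n => μ)
      ≤ ∫ Z, Ghat Z (what Z) ∂(Measure.pi fun _ : Fin n => μ) := by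
  have hnR : (0:ℝ) < n := by exact_mod_cast hn
  have hm : 0 < lam + γ := by
    by_contra hc
    push Not at hc
    nlinarith [mul_nonneg (neg_nonneg.2 hc) hnR.le]
  have hmn : 0 < (lam + γ) * n := mul_pos hm hnR
  have hmid : ∀ Z u v, Ghat Z ((1/2:ℝ) • u + (1/2:ℝ) • v) + lam / 8 * ‖u - v‖ ^ 2
      ≤ (Ghat Z u + Ghat Z v) / 2 := by
    intro Z u v
    have hs : ∑ i, (f ((1/2:ℝ) • u + (1/2:ℝ) • v) (Z i) + lam / 8 * ‖u - v‖ ^ 2)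
        ≤ ∑ i, (f u (Z i) + f v (Z i)) / 2 :=
      Finset.sum_le_sum fun i _ => aux_mid (fun w => f w (Z i)) _ lam (hf_strconv (Z i)) u v
    rw [Finset.sum_add_distrib, ← Finset.sum_div, Finset.sum_add_distrib, Finset.sum_const,
      Finset.card_univ, Fintype.card_fin, nsmul_eq_mul] at hs
    have hs2 := mul_le_mul_of_nonneg_left hs (by positivity : (0:ℝ) ≤ 1 / n)
    rw [mul_add, ← mul_assoc (1 / (n:ℝ)) n, one_div_mul_cancel hnR.ne', one_mul] at hs2
    rw [hGhat, hGhat, hGhat]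
    linarith
  have hgrow : ∀ Z, ∀ w ∈ Ωs, Ghat Z (what Z) + r (what Z) + (lam + γ) / 4 * ‖what Z - w‖ ^ 2
      ≤ Ghat Z w + r w := by
    intro Z w hw
    have h1 := hmid Z (what Z) w
    have h2 := aux_mid r _ γ hr_strconv (what Z) w
    have h3 := hwhat_min Z _ (hΩs (hwhat_mem Z) hw (by norm_num : (0:ℝ) ≤ 1/2)
      (by norm_num : (0:ℝ) ≤ 1/2) (by norm_num))
    linarith
  -- stability
  have hstab : ∀ (i : Fin n) (Z : Fin n → Ξ) (x : Ξ),
      (lam + γ) * n * (f (what (Function.update Z i x)) (Z i) - f (what Z) (Z i)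
        + f (what Z) x - f (what (Function.update Z i x)) x)
      ≤ 8 * β * (f (what (Function.update Z i x)) (Z i) + f (what Z) x) := by
    intro i Z x
    set v := what (Function.update Z i x) with hv
    set u := what Z with hu
    have hdiff : ∀ w, n * Ghat (Function.update Z i x) w = n * Ghat Z w + f w x - f w (Z i) := by
      intro w
      rw [hGhat, hGhat, ← mul_assoc, ← mul_assoc, mul_one_div_cancel hnR.ne', one_mul, one_mul,
        ← Finset.add_sum_erase Finset.univ _ (Finset.mem_univ i),
        ← Finset.add_sum_erase Finset.univ (fun j => f w (Z j)) (Finset.mem_univ i)]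
      have : ∑ j ∈ Finset.univ.erase i, f w (Function.update Z i x j)
          = ∑ j ∈ Finset.univ.erase i, f w (Z j) := by
        refine Finset.sum_congr rfl fun j hj => ?_
        rw [Function.update_of_ne (Finset.ne_of_mem_erase hj)]
      rw [this, Function.update_self]
      ring
    have g1 := mul_le_mul_of_nonneg_left (hgrow Z v (hwhat_mem _)) hnR.le
    have g2 := mul_le_mul_of_nonneg_left (hgrow (Function.update Z i x) u (hwhat_mem _)) hnR.le
    rw [← hv, norm_sub_rev v u] at g2
    rw [← hu] at g1
    have d1 := hdiff u
    have d2 := hdiff v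
    have k1 : (lam + γ) * n / 2 * ‖v - u‖ ^ 2 ≤
        f v (Z i) - f u (Z i) + f u x - f v x := by
      rw [norm_sub_rev v u]
      linarith
    have s1 := hf_strconv (Z i) u v
    have s2 := hf_strconv x v u
    have e : u - v = -(v - u) := by abel
    rw [e, inner_neg_right, norm_neg] at s1
    have p : 0 ≤ lam / 2 * ‖v - u‖ ^ 2 := by positivity
    have b1 := aux_self (fun w => f w (Z i)) _ β hβ (hf_nonneg (Z i)) (hf_smooth (Z i)) v
    have b2 := aux_self (fun w => f w x) _ β hβ (hf_nonneg x) (hf_smooth x) u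
    have := aux_alg (gradient (fun w => f w (Z i)) v) (gradient (fun w => f w x) u) (v - u)
      ((lam + γ) * n / 2) _ (4 * β * (f v (Z i) + f u x)) (by positivity) k1 (by linarith)
      (by linarith)
    linarith
  -- measurability and integrability
  have hmeas : Measurable (Function.uncurry f) := by
    have := measurable_uncurry_of_continuous_of_measurable (u := fun w ξ => f w ξ)
      (fun ξ => (hf_diff ξ).continuous) hf_meas
    exact this
  set P := Measure.pi fun _ : Fin n => μ with hP
  have hI1 : ∀ i, Integrable (fun Z => f (what Z) (Z i)) P := by
    intro i
    refine Integrable.mono' (hInt2.const_mul n)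
      (hmeas.comp (hwhat_meas.prodMk (measurable_pi_apply i))).aestronglyMeasurable ?_
    refine Filter.Eventually.of_forall fun Z => ?_
    rw [Real.norm_eq_abs, abs_of_nonneg (hf_nonneg _ _), hGhat, ← mul_assoc,
      mul_one_div_cancel hnR.ne', one_mul]
    exact Finset.single_le_sum (f := fun j => f (what Z) (Z j)) (fun j _ => hf_nonneg _ _)
      (Finset.mem_univ i)
  have hI2 : Integrable (fun p : (Fin n → Ξ) × Ξ => f (what p.1) p.2) (P.prod μ) := by
    refine (integrable_prod_iff (hmeas.comp ((hwhat_meas.comp measurable_fst).prodMk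
      measurable_snd)).aestronglyMeasurable).2 ⟨Filter.Eventually.of_forall fun Z => hG_int (what Z), ?_⟩
    refine hInt1.congr (Filter.Eventually.of_forall fun Z => ?_)
    simp only [hG]
    exact integral_congr_ae (Filter.Eventually.of_forall fun x => by
      simp [abs_of_nonneg (hf_nonneg _ _)])
  have hE2 : ∫ p : (Fin n → Ξ) × Ξ, f (what p.1) p.2 ∂(P.prod μ) = ∫ Z, G (what Z) ∂P := by
    rw [integral_prod _ hI2]
    simp only [hG]
  have hI1' : ∀ i, Integrable (fun p : (Fin n → Ξ) × Ξ => f (what p.1) (p.1 i)) (P.prod μ) :=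
    fun i => (hI1 i).comp_fst μ
  have hE1 : ∀ i, ∫ p : (Fin n → Ξ) × Ξ, f (what p.1) (p.1 i) ∂(P.prod μ)
      = ∫ Z, f (what Z) (Z i) ∂P := by
    intro i
    rw [integral_prod _ (hI1' i)]
    simp
  have hkey : ∀ i, (lam + γ) * n * (∫ Z, G (what Z) ∂P - ∫ Z, f (what Z) (Z i) ∂P)
      ≤ 8 * β * ∫ Z, G (what Z) ∂P := by
    intro i
    have hsw := aux_swap μ i
    rw [← hP] at hsw
    have hJ2 : Integrable (fun p : (Fin n → Ξ) × Ξ =>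
        f (what (Function.update p.1 i p.2)) (p.1 i)) (P.prod μ) :=
      hsw.integrable_comp_of_integrable hI2
    have hJ1 : Integrable (fun p : (Fin n → Ξ) × Ξ =>
        f (what (Function.update p.1 i p.2)) p.2) (P.prod μ) := by
      simpa [Function.comp_def] using hsw.integrable_comp_of_integrable (hI1' i)
    have hK2 : ∫ p : (Fin n → Ξ) × Ξ, f (what (Function.update p.1 i p.2)) (p.1 i) ∂(P.prod μ)
        = ∫ Z, G (what Z) ∂P := by
      rw [← hE2]
      have := integral_map (μ := P.prod μ) hsw.measurable.aemeasurable
        (f := fun p : (Fin n → Ξ) × Ξ => f (what p.1) p.2)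
        (by rw [hsw.map_eq]; exact hI2.aestronglyMeasurable)
      rw [hsw.map_eq] at this
      exact this.symm
    have hK1 : ∫ p : (Fin n → Ξ) × Ξ, f (what (Function.update p.1 i p.2)) p.2 ∂(P.prod μ)
        = ∫ Z, f (what Z) (Z i) ∂P := by
      rw [← hE1]
      have := integral_map (μ := P.prod μ) hsw.measurable.aemeasurable
        (f := fun p : (Fin n → Ξ) × Ξ => f (what p.1) (p.1 i))
        (by rw [hsw.map_eq]; exact (hI1' i).aestronglyMeasurable)
      rw [hsw.map_eq] at this
      simpa using this.symm
    have hle := integral_mono (μ := P.prod μ)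
      ((((hJ2.sub (hI1' i)).add hI2).sub hJ1).const_mul ((lam + γ) * n))
      ((hJ2.add hI2).const_mul (8 * β)) (fun p => hstab i p.1 p.2)
    rw [integral_const_mul, integral_const_mul, integral_sub' ((hJ2.sub (hI1' i)).add hI2) hJ1,
      integral_add' (hJ2.sub (hI1' i)) hI2, integral_sub' hJ2 (hI1' i), integral_add' hJ2 hI2,
      hK1, hK2, hE1, hE2] at hle
    linarith
  have hsum : ∫ Z, Ghat Z (what Z) ∂P = (1 / n : ℝ) * ∑ i, ∫ Z, f (what Z) (Z i) ∂P := by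
    simp only [hGhat]
    rw [integral_const_mul, integral_finsetSum _ fun i _ => hI1 i]
  have hkey2 : ∀ i, (1 - 8 * β / ((lam + γ) * n)) * ∫ Z, G (what Z) ∂P
      ≤ ∫ Z, f (what Z) (Z i) ∂P := by
    intro i
    have h1 := hkey i
    have h2 : ∫ Z, G (what Z) ∂P - ∫ Z, f (what Z) (Z i) ∂P
        ≤ 8 * β * (∫ Z, G (what Z) ∂P) / ((lam + γ) * n) := by
      rw [le_div_iff₀ hmn]; linarith
    have h3 : 8 * β * (∫ Z, G (what Z) ∂P) / ((lam + γ) * n)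
      = 8 * β / ((lam + γ) * n) * (∫ Z, G (what Z) ∂P) := by ring
    linarith
  have hfin := Finset.sum_le_sum fun i (_ : i ∈ (Finset.univ : Finset (Fin n))) => hkey2 i
  rw [Finset.sum_const, Finset.card_univ, Fintype.card_fin, nsmul_eq_mul] at hfin
  rw [hsum, one_div_mul_eq_div, le_div_iff₀ hnR]
  linarith
end

section
/- Let Ω ⊆ ℝ^d be convex, H : ℝ^d → ℝ, n ≥ 1, σ > 0, and let h, h′ : ℝ^d → ℝ be nonnegative, convex, differentiable and β-smooth. Assume that both F = H + h/n and F′ = H + h′/n are σ-strongly convex on Ω, and let u minimize F over Ω and u′ minimize F′ over Ω. Then ‖u′ − u‖ ≤ (√(8β)/(σn))·(√(h(u′)) + √(h′(u))). -/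
open scoped RealInnerProductSpace

theorem aux_deriv {g : ℝ → ℝ} {g' c : ℝ} (hg : HasDerivAt g g' 0)
    (h : ∀ t : ℝ, 0 < t → t < 1 → g 0 + t * c ≤ g t) : c ≤ g' := by
  have h1 := hg.tendsto_slope_zero_right
  refine ge_of_tendsto h1 ?_
  have h2 : Set.Ioo (0 : ℝ) 1 ∈ nhdsWithin (0 : ℝ) (Set.Ioi 0) :=
    Ioo_mem_nhdsGT one_pos
  filter_upwards [h2] with t ht
  have h3 := h t ht.1 ht.2
  have h4 := ht.1
  simp only [zero_add, smul_eq_mul]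
  rw [inv_mul_eq_div, le_div_iff₀ h4]
  linarith

theorem aux_line {E : Type*} [NormedAddCommGroup E] [InnerProductSpace ℝ E] [CompleteSpace E]
    {f : E → ℝ} {x : E} (hf : DifferentiableAt ℝ f x) (v : E) :
    HasDerivAt (fun t : ℝ => f (x + t • v)) ⟪gradient f x, v⟫ 0 := by
  have h1 : HasFDerivAt f (InnerProductSpace.toDual ℝ E (gradient f x)) x :=
    hf.hasGradientAt.hasFDerivAt
  have h2 : HasDerivAt (fun t : ℝ => x + t • v) v 0 := by
    simpa using ((hasDerivAt_id (0 : ℝ)).smul_const v).const_add x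
  have h1' : HasFDerivAt f (InnerProductSpace.toDual ℝ E (gradient f x)) (x + (0 : ℝ) • v) := by
    simpa using h1
  have h3 := h1'.comp_hasDerivAt (0 : ℝ) h2
  rw [InnerProductSpace.toDual_apply_apply] at h3
  exact h3

theorem aux_min {E : Type*} [NormedAddCommGroup E] [InnerProductSpace ℝ E] [CompleteSpace E]
    {f : E → ℝ} {s : Set E} (hs : Convex ℝ s) {x y : E} (hx : x ∈ s) (hy : y ∈ s)
    (hmin : ∀ w ∈ s, f x ≤ f w) : 0 ≤ ⟪gradient f x, y - x⟫ := by
  by_cases hf : DifferentiableAt ℝ f x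
  · refine aux_deriv (aux_line hf (y - x)) ?_
    intro t h0 h1
    have := hmin _ (hs.add_smul_sub_mem hx hy ⟨h0.le, h1.le⟩)
    simpa using this
  · rw [gradient_eq_zero_of_not_differentiableAt hf]
    simp

theorem aux_conv {E : Type*} [NormedAddCommGroup E] [InnerProductSpace ℝ E] [CompleteSpace E]
    {f : E → ℝ} (hc : ConvexOn ℝ Set.univ f) (hf : Differentiable ℝ f) (x y : E) :
    f x - f y ≤ ‖gradient f x‖ * ‖x - y‖ := by
  have h1 := (aux_line (hf x) (y - x)).neg
  have h2 : f x - f y ≤ -⟪gradient f x, y - x⟫ := by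
    refine aux_deriv h1 ?_
    intro t h0 h1
    have h3 := hc.2 (Set.mem_univ x) (Set.mem_univ y) (sub_nonneg.2 h1.le) h0.le (by ring)
    have h4 : (1 - t) • x + t • y = x + t • (y - x) := by module
    rw [h4] at h3
    simp only [smul_eq_mul] at h3
    simp only [Pi.neg_apply, zero_smul, add_zero]
    linarith
  rw [← inner_neg_right, neg_sub] at h2
  exact h2.trans (real_inner_le_norm _ _)

theorem aux_grad {E : Type*} [NormedAddCommGroup E] [InnerProductSpace ℝ E] [CompleteSpace E]
    {f : E → ℝ} {β : ℝ} (hβ : 0 < β) (h0 : ∀ w, 0 ≤ f w)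
    (hs : ∀ w₁ w₂, f w₁ ≤ f w₂ + ⟪gradient f w₂, w₁ - w₂⟫ + β / 2 * ‖w₁ - w₂‖ ^ 2) (x : E) :
    ‖gradient f x‖ ≤ Real.sqrt (8 * β) * Real.sqrt (f x) := by
  have h1 := hs (x - β⁻¹ • gradient f x) x
  have h2 := h0 (x - β⁻¹ • gradient f x)
  have h3 : x - β⁻¹ • gradient f x - x = -(β⁻¹ • gradient f x) := by abel
  rw [h3, inner_neg_right, norm_neg, norm_smul, real_inner_smul_right,
    real_inner_self_eq_norm_sq, mul_pow, Real.norm_eq_abs, sq_abs] at h1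
  have h4 : β / 2 * (β⁻¹ ^ 2 * ‖gradient f x‖ ^ 2) = β⁻¹ * ‖gradient f x‖ ^ 2 / 2 := by
    field_simp
  have h5 : β⁻¹ * ‖gradient f x‖ ^ 2 ≤ 2 * f x := by linarith
  rw [inv_mul_le_iff₀ hβ] at h5
  rw [← Real.sqrt_mul (by positivity)]
  apply Real.le_sqrt_of_sq_le
  nlinarith [mul_nonneg hβ.le (h0 x)]

theorem stmt19
    {d : ℕ} (n : ℕ) (hn : 1 ≤ n) (σ β : ℝ) (hσ : 0 < σ) (hβ : 0 < β)
    (Ωs : Set (EuclideanSpace ℝ (Fin d))) (hΩs : Convex ℝ Ωs)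
    (H h h' : EuclideanSpace ℝ (Fin d) → ℝ)
    (hh_nonneg : ∀ w, 0 ≤ h w) (hh'_nonneg : ∀ w, 0 ≤ h' w)
    (hh_convex : ConvexOn ℝ Set.univ h) (hh'_convex : ConvexOn ℝ Set.univ h')
    (hh_diff : Differentiable ℝ h) (hh'_diff : Differentiable ℝ h')
    (hh_smooth : ∀ w₁ w₂,
      h w₁ ≤ h w₂ + ⟪gradient h w₂, w₁ - w₂⟫ + β / 2 * ‖w₁ - w₂‖ ^ 2)
    (hh'_smooth : ∀ w₁ w₂,
      h' w₁ ≤ h' w₂ + ⟪gradient h' w₂, w₁ - w₂⟫ + β / 2 * ‖w₁ - w₂‖ ^ 2)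
    (F F' : EuclideanSpace ℝ (Fin d) → ℝ)
    (hF : F = fun w => H w + h w / n) (hF' : F' = fun w => H w + h' w / n)
    (hF_strconv : ∀ w₁ ∈ Ωs, ∀ w₂ ∈ Ωs,
      F w₂ + ⟪gradient F w₂, w₁ - w₂⟫ + σ / 2 * ‖w₁ - w₂‖ ^ 2 ≤ F w₁)
    (hF'_strconv : ∀ w₁ ∈ Ωs, ∀ w₂ ∈ Ωs,
      F' w₂ + ⟪gradient F' w₂, w₁ - w₂⟫ + σ / 2 * ‖w₁ - w₂‖ ^ 2 ≤ F' w₁)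
    (u u' : EuclideanSpace ℝ (Fin d)) (hu_mem : u ∈ Ωs) (hu'_mem : u' ∈ Ωs)
    (hu_min : ∀ w ∈ Ωs, F u ≤ F w) (hu'_min : ∀ w ∈ Ωs, F' u' ≤ F' w) :
    ‖u' - u‖ ≤ Real.sqrt (8 * β) / (σ * n) * (Real.sqrt (h u') + Real.sqrt (h' u)) := by
  have hn' : (0 : ℝ) < n := by exact_mod_cast hn
  have a1 := aux_min hΩs hu_mem hu'_mem hu_min
  have a2 := aux_min hΩs hu'_mem hu_mem hu'_min
  have b1 := hF_strconv u' hu'_mem u hu_mem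
  have b2 := hF'_strconv u hu_mem u' hu'_mem
  have c1 := aux_conv hh_convex hh_diff u' u
  have c2 := aux_conv hh'_convex hh'_diff u u'
  have d1 := mul_le_mul_of_nonneg_right (aux_grad hβ hh_nonneg hh_smooth u') (norm_nonneg (u' - u))
  have d2 := mul_le_mul_of_nonneg_right (aux_grad hβ hh'_nonneg hh'_smooth u) (norm_nonneg (u' - u))
  rw [norm_sub_rev u u'] at b2 c2
  have e : σ * ‖u' - u‖ ^ 2 ≤ (F u' - F' u') + (F' u - F u) := by linarith
  have e' : (F u' - F' u') + (F' u - F u) = ((h u' - h u) + (h' u - h' u')) / n := by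
    rw [hF, hF']; ring
  rw [e', le_div_iff₀ hn'] at e
  rw [div_mul_eq_mul_div, le_div_iff₀ (by positivity)]
  rcases (norm_nonneg (u' - u)).eq_or_lt with hD | hD
  · rw [← hD, zero_mul]; positivity
  · refine le_of_mul_le_mul_right ?_ hD
    linarith
end
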